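/- Let Γ be a monoid, R a commutative ring with identity, A a Γ-graded associative R-algebra, and B a Γ-algebra. Let N be a B-module such that for every β ∈ Γ the B-module _β N (same abelian group as N, action b ·_β x = b^β x) is projective. Then for every projective object P in the category A-Γ-gr of Γ-graded A-modules, the Γ-graded A ⋉_Γ B-module P ⋉_Γ N is projective in the category of Γ-graded A ⋉_Γ B-modules. -/

import Mathlib

open DirectSum TensorProduct

universe u

variable (Γ : Type u) [Monoid Γ] [DecidableEq Γ] (R : Type u) [CommRing R]
  (A : Type u) [Ring A] [Algebra R A]

/-- A `Γ`-grading on the `R`-algebra `A`: an internal direct sum decomposition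
`A = ⊕_{γ ∈ Γ} A_γ` into `R`-submodules with `1 ∈ A_e` and `A_γ · A_δ ⊆ A_{γδ}`. -/
structure GrAlgebra : Type (u + 1) where
  grading : Γ → Submodule R A
  internal : DirectSum.IsInternal grading
  one_mem : (1 : A) ∈ grading 1
  mul_mem : ∀ {γ δ : Γ} {a b : A},
    a ∈ grading γ → b ∈ grading δ → a * b ∈ grading (γ * δ)

variable (B : Type u) [Ring B] [Algebra R B]

/-- A `Γ`-algebra: an `R`-algebra `B` together with a right action of the monoid `Γ` on `B`
by `R`-algebra endomorphisms, written `b ↦ b^γ = (act γ) b`. -/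
structure GammaAlgebra : Type u where
  act : Γ → B →ₐ[R] B
  act_one : act 1 = AlgHom.id R B
  act_mul : ∀ γ δ : Γ, act (γ * δ) = (act δ).comp (act γ)

variable {Γ R A B}

/-- A `Γ`-graded left `A`-module: the objects of the category `A`-`Γ`-gr. -/
structure GrMod (𝒜 : GrAlgebra Γ R A) : Type (u + 1) where
  carrier : Type u
  [acg : AddCommGroup carrier]
  [modR : Module R carrier]
  [modA : Module A carrier]
  [tower : IsScalarTower R A carrier]
  grading : Γ → Submodule R carrier
  internal : DirectSum.IsInternal grading
  smul_mem : ∀ {γ δ : Γ} {a : A} {m : carrier},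
    a ∈ 𝒜.grading γ → m ∈ grading δ → a • m ∈ grading (γ * δ)

attribute [instance] GrMod.acg GrMod.modR GrMod.modA GrMod.tower

/-- Morphisms of the category `A`-`Γ`-gr. -/
structure GrHom {𝒜 : GrAlgebra Γ R A} (M N : GrMod 𝒜) where
  toLin : M.carrier →ₗ[A] N.carrier
  map_grading : ∀ γ : Γ, ∀ m ∈ M.grading γ, toLin m ∈ N.grading γ

/-- Projectivity in the category `A`-`Γ`-gr (lifting property against surjective graded
homomorphisms). -/
def GrProjective {𝒜 : GrAlgebra Γ R A} (P : GrMod 𝒜) : Prop :=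
  ∀ (M N : GrMod 𝒜) (f : GrHom M N) (g : GrHom P N),
    Function.Surjective f.toLin →
    ∃ h : GrHom P M, f.toLin.comp h.toLin = g.toLin

/-- Graded `A`-submodules of a graded module. -/
def IsGrSubmodule {𝒜 : GrAlgebra Γ R A} (M : GrMod 𝒜) (T : Submodule A M.carrier) : Prop :=
  (⨆ γ : Γ, M.grading γ ⊓ T.restrictScalars R) = T.restrictScalars R

/-- `N` is a superfluous subobject of `M` in the category `A`-`Γ`-gr. -/
def GrSuperfluous {𝒜 : GrAlgebra Γ R A} (M : GrMod 𝒜) (N : Submodule A M.carrier) : Prop :=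
  ∀ T : Submodule A M.carrier, IsGrSubmodule M T → N ⊔ T = ⊤ → T = ⊤

/-- The `B`-module `_β N`: same underlying abelian group as `N`, with the `B`-action
`b ·_β x = b^β • x`. -/
def TwistB (ρ : GammaAlgebra Γ R B) (β : Γ) (N : Type u) : Type u := N

instance (ρ : GammaAlgebra Γ R B) (β : Γ) (N : Type u) [AddCommGroup N] :
    AddCommGroup (TwistB ρ β N) := inferInstanceAs (AddCommGroup N)

instance (ρ : GammaAlgebra Γ R B) (β : Γ) (N : Type u) [AddCommGroup N] [Module R N] :
    Module R (TwistB ρ β N) := inferInstanceAs (Module R N)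

instance (ρ : GammaAlgebra Γ R B) (β : Γ) (N : Type u) [AddCommGroup N] [Module B N] :
    Module B (TwistB ρ β N) := Module.compHom N (ρ.act β).toRingHom

/-- A `Γ`-graded module over the twisted product `A ⋉_Γ B`, where the multiplication of
`A ⋉_Γ B` on the underlying `R`-module `A ⊗[R] B` is the given bilinear map `mul`.
The data is an `R`-bilinear action of `A ⊗[R] B` which is unital and multiplicative for
`mul`, together with an internal grading compatible with the grading of `A ⋉_Γ B`. -/
structure TwModStr (𝒜 : GrAlgebra Γ R A)
    (mul : (A ⊗[R] B) →ₗ[R] (A ⊗[R] B) →ₗ[R] (A ⊗[R] B))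
    (X : Type u) [AddCommGroup X] [Module R X] : Type u where
  act : (A ⊗[R] B) →ₗ[R] X →ₗ[R] X
  one_act : ∀ x : X, act ((1 : A) ⊗ₜ[R] (1 : B)) x = x
  mul_act : ∀ (p q : A ⊗[R] B) (x : X), act (mul p q) x = act p (act q x)
  grading : Γ → Submodule R X
  internal : DirectSum.IsInternal grading
  act_mem : ∀ {γ δ : Γ} {a : A} {b : B} {x : X},
    a ∈ 𝒜.grading γ → x ∈ grading δ → act (a ⊗ₜ[R] b) x ∈ grading (γ * δ)

/-- Morphisms in the category `(A ⋉_Γ B)`-`Γ`-gr: `R`-linear, `A ⋉_Γ B`-equivariant and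
degree preserving maps. -/
def IsTwHom {𝒜 : GrAlgebra Γ R A}
    {mul : (A ⊗[R] B) →ₗ[R] (A ⊗[R] B) →ₗ[R] (A ⊗[R] B)}
    {X Y : Type u} [AddCommGroup X] [Module R X] [AddCommGroup Y] [Module R Y]
    (sX : TwModStr 𝒜 mul X) (sY : TwModStr 𝒜 mul Y) (f : X →ₗ[R] Y) : Prop :=
  (∀ (p : A ⊗[R] B) (x : X), f (sX.act p x) = sY.act p (f x)) ∧
  (∀ γ : Γ, ∀ x ∈ sX.grading γ, f x ∈ sY.grading γ)

/-- Graded `A ⋉_Γ B`-submodules: `R`-submodules stable under the action and equal to the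
sum of their homogeneous components. -/
def IsTwSubmodule {𝒜 : GrAlgebra Γ R A}
    {mul : (A ⊗[R] B) →ₗ[R] (A ⊗[R] B) →ₗ[R] (A ⊗[R] B)}
    {X : Type u} [AddCommGroup X] [Module R X]
    (sX : TwModStr 𝒜 mul X) (T : Submodule R X) : Prop :=
  (∀ (p : A ⊗[R] B), ∀ x ∈ T, sX.act p x ∈ T) ∧
  (⨆ γ : Γ, sX.grading γ ⊓ T) = T

/-- Projectivity in the category `(A ⋉_Γ B)`-`Γ`-gr (lifting property against surjective
graded homomorphisms). -/
def TwProjective {𝒜 : GrAlgebra Γ R A}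
    {mul : (A ⊗[R] B) →ₗ[R] (A ⊗[R] B) →ₗ[R] (A ⊗[R] B)}
    {P : Type u} [AddCommGroup P] [Module R P] (sP : TwModStr 𝒜 mul P) : Prop :=
  ∀ (X Y : Type u) [AddCommGroup X] [Module R X] [AddCommGroup Y] [Module R Y],
    ∀ (sX : TwModStr 𝒜 mul X) (sY : TwModStr 𝒜 mul Y)
      (f : X →ₗ[R] Y) (g : P →ₗ[R] Y),
      IsTwHom sX sY f → Function.Surjective f → IsTwHom sP sY g →
      ∃ h : P →ₗ[R] X, IsTwHom sP sX h ∧ f.comp h = g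

/-- `mul` is the multiplication of the twisted product `A ⋉_Γ B`. -/
def IsTwistedMul (𝒜 : GrAlgebra Γ R A) (ρ : GammaAlgebra Γ R B)
    (mul : (A ⊗[R] B) →ₗ[R] (A ⊗[R] B) →ₗ[R] (A ⊗[R] B)) : Prop :=
  ∀ (β : Γ) (a a' : A) (b b' : B), a' ∈ 𝒜.grading β →
    mul (a ⊗ₜ[R] b) (a' ⊗ₜ[R] b') = (a * a') ⊗ₜ[R] (ρ.act β b * b')

namespace IsTwistedMul

variable {𝒜 : GrAlgebra Γ R A} {ρ : GammaAlgebra Γ R B}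
  {mul : (A ⊗[R] B) →ₗ[R] (A ⊗[R] B) →ₗ[R] (A ⊗[R] B)}

theorem tmul_one_tmul_one (hmul : IsTwistedMul 𝒜 ρ mul) (a a' : A) :
    mul (a ⊗ₜ[R] 1) (a' ⊗ₜ[R] 1) = (a * a') ⊗ₜ[R] 1 := by
  have ha' : a' ∈ ⨆ γ, 𝒜.grading γ := by
    rw [𝒜.internal.submodule_iSup_eq_top]; trivial
  induction ha' using Submodule.iSup_induction' with
  | mem β a' h => simp [hmul β a a' 1 1 h]
  | zero => simp
  | add x y _ _ hx hy => simp [TensorProduct.add_tmul, mul_add, hx, hy]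

theorem tmul_one_tmul (hmul : IsTwistedMul 𝒜 ρ mul) (a : A) (b b' : B) :
    mul (a ⊗ₜ[R] b) (1 ⊗ₜ[R] b') = a ⊗ₜ[R] (b * b') := by
  simp [hmul 1 a 1 b b' 𝒜.one_mem, ρ.act_one]

end IsTwistedMul

namespace TwModStr

variable {𝒜 : GrAlgebra Γ R A} {ρ : GammaAlgebra Γ R B}
  {mul : (A ⊗[R] B) →ₗ[R] (A ⊗[R] B) →ₗ[R] (A ⊗[R] B)}
  {X Y : Type u} [AddCommGroup X] [Module R X] [AddCommGroup Y] [Module R Y]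

/-- The action of `B` on an `A ⋉_Γ B`-module through `b ↦ 1 ⊗ b`. -/
def actB (s : TwModStr 𝒜 mul X) (hmul : IsTwistedMul 𝒜 ρ mul) : B →+* Module.End R X where
  toFun b := s.act (1 ⊗ₜ[R] b)
  map_one' := LinearMap.ext s.one_act
  map_mul' b b' := LinearMap.ext fun x => by
    rw [← hmul.tmul_one_tmul, s.mul_act]; rfl
  map_zero' := by simp
  map_add' b b' := by simp [TensorProduct.tmul_add]

theorem act_tmul (s : TwModStr 𝒜 mul X) (hmul : IsTwistedMul 𝒜 ρ mul) (a : A) (b : B) (x : X) :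
    s.act (a ⊗ₜ[R] b) x = s.act (a ⊗ₜ[R] 1) (s.act (1 ⊗ₜ[R] b) x) := by
  rw [← s.mul_act, hmul.tmul_one_tmul, one_mul]

theorem act_one_tmul_act (s : TwModStr 𝒜 mul X) (hmul : IsTwistedMul 𝒜 ρ mul)
    {β : Γ} {a : A} (ha : a ∈ 𝒜.grading β) (b : B) (x : X) :
    s.act (1 ⊗ₜ[R] b) (s.act (a ⊗ₜ[R] 1) x) =
      s.act (a ⊗ₜ[R] 1) (s.act (1 ⊗ₜ[R] ρ.act β b) x) := by
  rw [← s.mul_act, hmul β 1 a b 1 ha, ← s.act_tmul hmul, one_mul, mul_one]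

theorem act_one_tmul_mem (s : TwModStr 𝒜 mul X) {γ : Γ} (b : B) {x : X} (hx : x ∈ s.grading γ) :
    s.act (1 ⊗ₜ[R] b) x ∈ s.grading γ := by
  simpa using s.act_mem (b := b) 𝒜.one_mem hx

/-- A surjective graded homomorphism is surjective in each degree. -/
theorem exists_mem_grading_of_surjective {sX : TwModStr 𝒜 mul X} {sY : TwModStr 𝒜 mul Y}
    {f : X →ₗ[R] Y} (hf : IsTwHom sX sY f) (hsurj : Function.Surjective f)
    {γ : Γ} {y : Y} (hy : y ∈ sY.grading γ) : ∃ x ∈ sX.grading γ, f x = y := by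
  obtain ⟨x, rfl⟩ := hsurj y
  have hx : x ∈ ⨆ γ, sX.grading γ := by
    rw [sX.internal.submodule_iSup_eq_top]; trivial
  rw [iSup_split_single _ γ] at hx
  obtain ⟨u, hu, v, hv, rfl⟩ := Submodule.mem_sup.1 hx
  refine ⟨u, hu, ?_⟩
  have hle : (⨆ i, ⨆ (_ : i ≠ γ), sX.grading i) ≤
      (⨆ i, ⨆ (_ : i ≠ γ), sY.grading i).comap f :=
    iSup₂_le fun i hi x hx =>
      (le_iSup₂_of_le (f := fun i (_ : i ≠ γ) => sY.grading i) i hi le_rfl) (hf.2 i x hx)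
  have hfv : f v ∈ sY.grading γ := by
    have := (sY.grading γ).sub_mem hy (hf.2 γ u hu)
    simpa using this
  have := (Submodule.disjoint_def.1 (sY.internal.submodule_iSupIndep γ)) _ hfv (hle hv)
  simp [this]

variable (N : Type u) [AddCommGroup N] [Module R N] [Module B N]

/-- The `B`-linear maps from `_γ N` to the degree `γ` component of `X`. -/
def homGrading (ρ : GammaAlgebra Γ R B) (s : TwModStr 𝒜 mul X) (γ : Γ) :
    Submodule R (N →ₗ[R] X) where
  carrier := {φ | (∀ x, φ x ∈ s.grading γ) ∧
    ∀ (b : B) (x : N), φ (ρ.act γ b • x) = s.act (1 ⊗ₜ[R] b) (φ x)}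
  add_mem' h₁ h₂ :=
    ⟨fun x => Submodule.add_mem _ (h₁.1 x) (h₂.1 x), fun b x => by simp [h₁.2, h₂.2]⟩
  zero_mem' := ⟨fun x => Submodule.zero_mem _, fun b x => by simp⟩
  smul_mem' r _ h := ⟨fun x => Submodule.smul_mem _ r (h.1 x), fun b x => by simp [h.2]⟩

variable {N}

theorem act_comp_mem_homGrading (s : TwModStr 𝒜 mul X) (hmul : IsTwistedMul 𝒜 ρ mul)
    {γ δ : Γ} {a : A} {φ : N →ₗ[R] X} (ha : a ∈ 𝒜.grading γ) (hφ : φ ∈ s.homGrading N ρ δ) :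
    s.act (a ⊗ₜ[R] 1) ∘ₗ φ ∈ s.homGrading N ρ (γ * δ) := by
  refine ⟨fun x => s.act_mem ha (hφ.1 x), fun b x => ?_⟩
  rw [LinearMap.comp_apply, LinearMap.comp_apply, s.act_one_tmul_act hmul ha, ρ.act_mul,
    ← hφ.2]
  rfl

theorem act_comp_mem_iSup_homGrading (s : TwModStr 𝒜 mul X) (hmul : IsTwistedMul 𝒜 ρ mul)
    (a : A) {φ : N →ₗ[R] X} (hφ : φ ∈ ⨆ γ, s.homGrading N ρ γ) :
    s.act (a ⊗ₜ[R] 1) ∘ₗ φ ∈ ⨆ γ, s.homGrading N ρ γ := by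
  have ha : a ∈ ⨆ γ, 𝒜.grading γ := by
    rw [𝒜.internal.submodule_iSup_eq_top]; trivial
  induction ha using Submodule.iSup_induction' with
  | mem β a ha =>
    induction hφ using Submodule.iSup_induction' with
    | mem δ φ hφ =>
      exact Submodule.mem_iSup_of_mem _ (s.act_comp_mem_homGrading hmul ha hφ)
    | zero => simp
    | add φ ψ _ _ hφ hψ => rw [LinearMap.comp_add]; exact Submodule.add_mem _ hφ hψ
  | zero => simp
  | add x y _ _ hx hy =>
    rw [TensorProduct.add_tmul, map_add, LinearMap.add_comp]; exact Submodule.add_mem _ hx hy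

theorem iSupIndep_homGrading (s : TwModStr 𝒜 mul X) : iSupIndep (s.homGrading N ρ) := by
  intro γ
  rw [Submodule.disjoint_def]
  intro φ hφ hφ'
  ext x
  have hle : (⨆ i, ⨆ (_ : i ≠ γ), s.homGrading N ρ i) ≤
      (⨆ i, ⨆ (_ : i ≠ γ), s.grading i).comap (LinearMap.applyₗ x) :=
    iSup₂_le fun i hi ψ hψ =>
      (le_iSup₂_of_le (f := fun i (_ : i ≠ γ) => s.grading i) i hi le_rfl) (hψ.1 x)
  exact (Submodule.disjoint_def.1 (s.internal.submodule_iSupIndep γ)) _ (hφ.1 x) (hle hφ')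

/-- The graded `A`-module `⊕_γ Hom_B(_γ N, X_γ)`, realised inside `Hom_R(N, X)`. The functor
`X ↦ s.homGrMod` is right adjoint to `P ↦ P ⋉_Γ N`. -/
def homGrMod (N : Type u) [AddCommGroup N] [Module R N] [Module B N]
    (s : TwModStr 𝒜 mul X) (hmul : IsTwistedMul 𝒜 ρ mul) : GrMod 𝒜 where
  carrier := ↥(⨆ γ, s.homGrading N ρ γ)
  modA :=
    { smul a φ := ⟨s.act (a ⊗ₜ[R] 1) ∘ₗ φ.1, s.act_comp_mem_iSup_homGrading hmul a φ.2⟩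
      one_smul φ := Subtype.ext <| LinearMap.ext fun x => s.one_act _
      mul_smul a a' φ := Subtype.ext <| LinearMap.ext fun x => by
        change s.act _ _ = s.act _ (s.act _ _)
        rw [← s.mul_act, hmul.tmul_one_tmul_one]
      smul_zero a := Subtype.ext <| LinearMap.comp_zero _
      smul_add a φ ψ := Subtype.ext <| LinearMap.comp_add _ _ _
      add_smul a a' φ := Subtype.ext <| LinearMap.ext fun x => by
        change s.act _ _ = s.act _ _ + s.act _ _
        rw [TensorProduct.add_tmul, map_add]; rfl
      zero_smul φ := Subtype.ext <| LinearMap.ext fun x => by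
        change s.act _ _ = 0
        simp }
  tower := by
    refine @IsScalarTower.mk _ _ _ _ (_) _ fun r a φ => Subtype.ext <| LinearMap.ext fun x => ?_
    change s.act _ _ = r • s.act _ _
    rw [← TensorProduct.smul_tmul', map_smul]; rfl
  grading γ := (s.homGrading N ρ γ).submoduleOf (⨆ γ, s.homGrading N ρ γ)
  internal := by
    rw [DirectSum.isInternal_submodule_iff_iSupIndep_and_iSup_eq_top]
    constructor
    · intro γ
      rw [Submodule.disjoint_def]
      intro φ hφ hφ'
      have hle : (⨆ i, ⨆ (_ : i ≠ γ), (s.homGrading N ρ i).submoduleOf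
          (⨆ γ, s.homGrading N ρ γ)) ≤
          (⨆ i, ⨆ (_ : i ≠ γ), s.homGrading N ρ i).submoduleOf (⨆ γ, s.homGrading N ρ γ) :=
        iSup₂_le fun i hi => Submodule.comap_mono <|
          le_iSup₂_of_le (f := fun i (_ : i ≠ γ) => s.homGrading N ρ i) i hi le_rfl
      exact Subtype.ext <|
        (Submodule.disjoint_def.1 (s.iSupIndep_homGrading γ)) _ hφ (hle hφ')
    · refine Submodule.map_injective_of_injective (Submodule.subtype_injective _) ?_
      rw [Submodule.map_iSup, Submodule.map_subtype_top]
      refine iSup_congr fun γ => ?_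
      exact (Submodule.map_comap_subtype _ _).trans (inf_eq_right.2 (le_iSup _ γ))
  smul_mem ha hφ := s.act_comp_mem_homGrading hmul ha hφ

/-- Projectivity of `_γ N` lets us lift `B`-linear maps `_γ N → Y_γ` along graded surjections. -/
theorem exists_homGrading_comp_eq [IsScalarTower R B N]
    {sX : TwModStr 𝒜 mul X} {sY : TwModStr 𝒜 mul Y} (hmul : IsTwistedMul 𝒜 ρ mul)
    {f : X →ₗ[R] Y} (hf : IsTwHom sX sY f) (hsurj : Function.Surjective f)
    {γ : Γ} (hN : Module.Projective B (TwistB ρ γ N))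
    {φ : N →ₗ[R] Y} (hφ : φ ∈ sY.homGrading N ρ γ) :
    ∃ ψ ∈ sX.homGrading N ρ γ, f ∘ₗ ψ = φ := by
  let _ : Module B X := Module.compHom X (sX.actB hmul)
  let _ : Module B Y := Module.compHom Y (sY.actB hmul)
  let Xγ : Submodule B X :=
    { (sX.grading γ).toAddSubmonoid with
      smul_mem' := fun b _ hx => sX.act_one_tmul_mem b hx }
  let Yγ : Submodule B Y :=
    { (sY.grading γ).toAddSubmonoid with
      smul_mem' := fun b _ hy => sY.act_one_tmul_mem b hy }
  let fγ : Xγ →ₗ[B] Yγ :=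
    { toFun := fun x => ⟨f x.1, hf.2 γ x.1 x.2⟩
      map_add' := fun x y => Subtype.ext (map_add f x.1 y.1)
      map_smul' := fun b x => Subtype.ext (hf.1 (1 ⊗ₜ[R] b) x.1) }
  let φγ : TwistB ρ γ N →ₗ[B] Yγ :=
    { toFun := fun x => ⟨φ x, hφ.1 x⟩
      map_add' := fun x y => Subtype.ext (map_add φ x y)
      map_smul' := fun b x => Subtype.ext (hφ.2 b x) }
  have hfγ : Function.Surjective fγ := fun y =>
    let ⟨x, hx, hxy⟩ := exists_mem_grading_of_surjective hf hsurj y.2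
    ⟨⟨x, hx⟩, Subtype.ext hxy⟩
  obtain ⟨ψ, hψ⟩ := Module.projective_lifting_property fγ φγ hfγ
  have hsmul (b : B) (x : N) :
      (ψ (ρ.act γ b • x : N)).1 = sX.act (1 ⊗ₜ[R] b) (ψ x).1 :=
    congrArg Subtype.val (ψ.map_smul b x)
  refine ⟨{ toFun := fun x => (ψ x).1
            map_add' := fun x y => congrArg Subtype.val (ψ.map_add x y)
            map_smul' := fun r x => ?_ }, ⟨fun x => (ψ x).2, hsmul⟩, ?_⟩
  · have := hsmul (algebraMap R B r) x
    rw [AlgHom.commutes, algebraMap_smul, Algebra.algebraMap_eq_smul_one,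
      TensorProduct.tmul_smul, map_smul, LinearMap.smul_apply, sX.one_act] at this
    exact this
  · ext x
    exact congrArg Subtype.val (LinearMap.congr_fun hψ x)

end TwModStr

namespace IsTwHom

variable {𝒜 : GrAlgebra Γ R A} {ρ : GammaAlgebra Γ R B}
  {mul : (A ⊗[R] B) →ₗ[R] (A ⊗[R] B) →ₗ[R] (A ⊗[R] B)}
  {X Y : Type u} [AddCommGroup X] [Module R X] [AddCommGroup Y] [Module R Y]
  {sX : TwModStr 𝒜 mul X} {sY : TwModStr 𝒜 mul Y} {f : X →ₗ[R] Y}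
  {N : Type u} [AddCommGroup N] [Module R N] [Module B N]

theorem comp_mem_homGrading (hf : IsTwHom sX sY f) {γ : Γ} {φ : N →ₗ[R] X}
    (hφ : φ ∈ sX.homGrading N ρ γ) : f ∘ₗ φ ∈ sY.homGrading N ρ γ :=
  ⟨fun x => hf.2 γ _ (hφ.1 x), fun b x => by simp [hφ.2, hf.1]⟩

theorem comp_mem_iSup_homGrading (hf : IsTwHom sX sY f) {φ : N →ₗ[R] X}
    (hφ : φ ∈ ⨆ γ, sX.homGrading N ρ γ) : f ∘ₗ φ ∈ ⨆ γ, sY.homGrading N ρ γ := by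
  induction hφ using Submodule.iSup_induction' with
  | mem γ φ hφ => exact Submodule.mem_iSup_of_mem γ (hf.comp_mem_homGrading hφ)
  | zero => simp
  | add φ ψ _ _ hφ hψ => rw [LinearMap.comp_add]; exact Submodule.add_mem _ hφ hψ

/-- Postcomposition with a graded homomorphism, as a morphism of graded `A`-modules. -/
def homGrHom (N : Type u) [AddCommGroup N] [Module R N] [Module B N]
    (hf : IsTwHom sX sY f) (hmul : IsTwistedMul 𝒜 ρ mul) :
    GrHom (sX.homGrMod N hmul) (sY.homGrMod N hmul) where
  toLin :=
    { toFun := fun φ => ⟨f ∘ₗ φ.1, hf.comp_mem_iSup_homGrading φ.2⟩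
      map_add' := fun φ ψ => Subtype.ext (LinearMap.comp_add φ.1 ψ.1 f)
      map_smul' := fun a φ => Subtype.ext <| LinearMap.ext fun x => hf.1 (a ⊗ₜ[R] 1) (φ.1 x) }
  map_grading _ _ hφ := hf.comp_mem_homGrading hφ

theorem homGrHom_surjective [IsScalarTower R B N] (hf : IsTwHom sX sY f)
    (hmul : IsTwistedMul 𝒜 ρ mul) (hsurj : Function.Surjective f)
    (hN : ∀ β : Γ, Module.Projective B (TwistB ρ β N)) :
    Function.Surjective (hf.homGrHom N hmul).toLin := by
  rintro ⟨φ, hφ⟩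
  suffices ∃ ψ ∈ ⨆ γ, sX.homGrading N ρ γ, f ∘ₗ ψ = φ from
    let ⟨ψ, hψ, h⟩ := this
    ⟨⟨ψ, hψ⟩, Subtype.ext h⟩
  induction hφ using Submodule.iSup_induction' with
  | mem γ φ hφ =>
    obtain ⟨ψ, hψ, h⟩ := TwModStr.exists_homGrading_comp_eq hmul hf hsurj (hN γ) hφ
    exact ⟨ψ, Submodule.mem_iSup_of_mem γ hψ, h⟩
  | zero => exact ⟨0, Submodule.zero_mem _, LinearMap.comp_zero f⟩
  | add φ φ' _ _ h h' =>
    obtain ⟨ψ, hψ, rfl⟩ := h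
    obtain ⟨ψ', hψ', rfl⟩ := h'
    exact ⟨ψ + ψ', Submodule.add_mem _ hψ hψ', LinearMap.comp_add ψ ψ' f⟩

end IsTwHom

section Adjunction

variable {𝒜 : GrAlgebra Γ R A} {ρ : GammaAlgebra Γ R B}
  {mul : (A ⊗[R] B) →ₗ[R] (A ⊗[R] B) →ₗ[R] (A ⊗[R] B)}
  {X : Type u} [AddCommGroup X] [Module R X] {sX : TwModStr 𝒜 mul X}
  {N : Type u} [AddCommGroup N] [Module R N] [Module B N]
  {P : GrMod 𝒜} {sQ : TwModStr 𝒜 mul (P.carrier ⊗[R] N)}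

theorem GrMod.mem_iSup_grading (P : GrMod 𝒜) (m : P.carrier) : m ∈ ⨆ γ, P.grading γ := by
  rw [P.internal.submodule_iSup_eq_top]; trivial

theorem IsTwHom.exists_curry
    (hmul : IsTwistedMul 𝒜 ρ mul)
    (hact : ∀ (γ : Γ) (a : A) (b : B) (m : P.carrier) (x : N), m ∈ P.grading γ →
      sQ.act (a ⊗ₜ[R] b) (m ⊗ₜ[R] x) = (a • m) ⊗ₜ[R] (ρ.act γ b • x))
    (hgr : ∀ (γ : Γ) (m : P.carrier) (x : N), m ∈ P.grading γ → m ⊗ₜ[R] x ∈ sQ.grading γ)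
    {g : P.carrier ⊗[R] N →ₗ[R] X} (hg : IsTwHom sQ sX g) :
    ∃ k : GrHom P (sX.homGrMod N hmul), ∀ m x, (k.toLin m).1 x = g (m ⊗ₜ[R] x) := by
  have hmem {γ : Γ} {m : P.carrier} (hm : m ∈ P.grading γ) :
      TensorProduct.curry g m ∈ sX.homGrading N ρ γ := by
    refine ⟨fun x => hg.2 γ _ (hgr γ m x hm), fun b x => ?_⟩
    rw [TensorProduct.curry_apply, TensorProduct.curry_apply, ← hg.1, hact γ _ _ _ _ hm, one_smul]
  have hmem' (m : P.carrier) : TensorProduct.curry g m ∈ ⨆ γ, sX.homGrading N ρ γ := by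
    induction P.mem_iSup_grading m using Submodule.iSup_induction' with
    | mem γ m hm => exact Submodule.mem_iSup_of_mem γ (hmem hm)
    | zero => simp
    | add m m' _ _ h h' => rw [map_add]; exact Submodule.add_mem _ h h'
  have hsmul (a : A) (m : P.carrier) (x : N) :
      g ((a • m) ⊗ₜ[R] x) = sX.act (a ⊗ₜ[R] 1) (g (m ⊗ₜ[R] x)) := by
    induction P.mem_iSup_grading m using Submodule.iSup_induction' with
    | mem γ m hm => rw [← hg.1, hact γ _ _ _ _ hm, map_one, one_smul]
    | zero => simp
    | add m m' _ _ h h' => simp [TensorProduct.add_tmul, h, h']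
  exact ⟨{ toLin :=
            { toFun := fun m => ⟨TensorProduct.curry g m, hmem' m⟩
              map_add' := fun m m' => Subtype.ext (map_add _ m m')
              map_smul' := fun a m => Subtype.ext <| LinearMap.ext fun x => hsmul a m x }
           map_grading := fun _ _ hm => hmem hm }, fun _ _ => rfl⟩

theorem GrHom.exists_uncurry
    (hmul : IsTwistedMul 𝒜 ρ mul)
    (hact : ∀ (γ : Γ) (a : A) (b : B) (m : P.carrier) (x : N), m ∈ P.grading γ →
      sQ.act (a ⊗ₜ[R] b) (m ⊗ₜ[R] x) = (a • m) ⊗ₜ[R] (ρ.act γ b • x))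
    (hgr : ∀ γ : Γ, sQ.grading γ =
      LinearMap.range (TensorProduct.map (P.grading γ).subtype
        (LinearMap.id : N →ₗ[R] N)))
    (k : GrHom P (sX.homGrMod N hmul)) :
    ∃ h : P.carrier ⊗[R] N →ₗ[R] X, IsTwHom sQ sX h ∧
      ∀ m x, h (m ⊗ₜ[R] x) = (k.toLin m).1 x := by
  let h : P.carrier ⊗[R] N →ₗ[R] X := TensorProduct.lift
    ((⨆ γ, sX.homGrading N ρ γ).subtype ∘ₗ (k.toLin.restrictScalars R))
  have happ (m : P.carrier) (x : N) : h (m ⊗ₜ[R] x) = (k.toLin m).1 x := rfl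
  refine ⟨h, ⟨fun p q => ?_, fun γ q hq => ?_⟩, happ⟩
  · induction p using TensorProduct.induction_on with
    | zero => simp
    | add p p' hp hp' => simp [hp, hp']
    | tmul a b =>
      induction q using TensorProduct.induction_on with
      | zero => simp
      | add q q' hq hq' => simp only [map_add, hq, hq']
      | tmul m x =>
        induction P.mem_iSup_grading m using Submodule.iSup_induction' with
        | zero => simp
        | add m m' _ _ hm hm' => simp only [TensorProduct.add_tmul, map_add, hm, hm']
        | mem γ m hm =>
          have hB : (k.toLin m).1 (ρ.act γ b • x) = sX.act (1 ⊗ₜ[R] b) ((k.toLin m).1 x) :=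
            (k.map_grading γ m hm).2 b x
          rw [hact γ _ _ _ _ hm, happ, happ, sX.act_tmul hmul, ← hB, k.toLin.map_smul]
          rfl
  · rw [hgr] at hq
    obtain ⟨t, rfl⟩ := hq
    induction t using TensorProduct.induction_on with
    | zero => simp
    | add t t' ht ht' => rw [map_add, map_add]; exact Submodule.add_mem _ ht ht'
    | tmul m x => exact (k.map_grading γ m.1 m.2).1 x

end Adjunction


/-- Let `N` be a `B`-module such that every twist `_β N` is a projective `B`-module.
If `P` is a projective object of the category `A`-`Γ`-gr, then `P ⋉_Γ N` (given by a
graded `A ⋉_Γ B`-module structure `sQ` on `P ⊗[R] N` with the characteristic action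
`(a ⊗ b)(m ⊗ x) = (a•m) ⊗ (b^γ • x)` for `m ∈ P_γ` and grading `(P ⋉ N)_γ = P_γ ⊗ N`)
is a projective object of the category of `Γ`-graded `A ⋉_Γ B`-modules. -/
theorem twistedProduct_projective {Γ R A B : Type u} [Monoid Γ] [DecidableEq Γ] [CommRing R]
    [Ring A] [Algebra R A] [Ring B] [Algebra R B]
    (𝒜 : GrAlgebra Γ R A) (ρ : GammaAlgebra Γ R B)
    (mul : (A ⊗[R] B) →ₗ[R] (A ⊗[R] B) →ₗ[R] (A ⊗[R] B))
    (hmul : ∀ (β : Γ) (a a' : A) (b b' : B), a' ∈ 𝒜.grading β →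
      mul (a ⊗ₜ[R] b) (a' ⊗ₜ[R] b') = (a * a') ⊗ₜ[R] (ρ.act β b * b'))
    (N : Type u) [AddCommGroup N] [Module R N] [Module B N] [IsScalarTower R B N]
    (hNproj : ∀ β : Γ, Module.Projective B (TwistB ρ β N))
    (P : GrMod 𝒜) (hP : GrProjective P)
    (sQ : TwModStr 𝒜 mul (P.carrier ⊗[R] N))
    (hact : ∀ (γ : Γ) (a : A) (b : B) (m : P.carrier) (x : N), m ∈ P.grading γ →
      sQ.act (a ⊗ₜ[R] b) (m ⊗ₜ[R] x) = (a • m) ⊗ₜ[R] (ρ.act γ b • x))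
    (hgr : ∀ γ : Γ, sQ.grading γ =
      LinearMap.range (TensorProduct.map (P.grading γ).subtype
        (LinearMap.id : N →ₗ[R] N))) :
    TwProjective sQ := by
  intro X Y _ _ _ _ sX sY f g hf hsurj hg
  have hmul : IsTwistedMul 𝒜 ρ mul := hmul
  obtain ⟨k, hk⟩ := hg.exists_curry hmul hact fun γ m x hm => by
    rw [hgr]
    exact ⟨⟨m, hm⟩ ⊗ₜ[R] x, rfl⟩
  obtain ⟨l, hl⟩ := hP _ _ (hf.homGrHom N hmul) k (hf.homGrHom_surjective hmul hsurj hNproj)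
  obtain ⟨h, hh, happ⟩ := l.exists_uncurry hmul hact hgr
  refine ⟨h, hh, TensorProduct.ext' fun m x => ?_⟩
  rw [LinearMap.comp_apply, happ, ← hk, ← hl]
  rfl
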